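/- Let A be a nonempty finite set, let Q_X and Q_Y be strictly positive stochastic matrices on A with stationary probability vectors mu and mu~, and let P, P~ be the stationary Markov measures determined by (Q_X, mu) and (Q_Y, mu~). Then for every p with |p| < 1, lim_{n->infinity} (1/n) [ log E_{P tensor P~ tensor P} ( ( W_n(X|Y) / W_n(X|X') )^p ) - log ( sum_{a in A^n} P_n(a)^{1+p} * P~_n(a)^{-p} ) ] = 0, i.e. the two sequences are logarithmically equivalent. -/

import Mathlib

open MeasureTheory Filter Finset Real

/-- Waiting time: `W_n(x|y) = inf { k ≥ 1 : y_{k+i} = x_i for all 1 ≤ i ≤ n }`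
(with the convention `sInf ∅ = 0` in `ℕ`; the set is a.s. nonempty). -/
noncomputable def waitingTime {A : Type*} (n : ℕ) (x y : ℕ → A) : ℕ :=
  sInf {k | 1 ≤ k ∧ ∀ i, 1 ≤ i → i ≤ n → y (k + i) = x i}

/-- Probability of the cylinder determined by a word `a ∈ A^n` placed on coordinates
`1, …, n`. -/
noncomputable def wordProb {A : Type*} [MeasurableSpace A]
    (P : Measure (ℕ → A)) (n : ℕ) (a : Fin n → A) : ℝ :=
  (P {ω | ∀ i : Fin n, ω (i.1 + 1) = a i}).toReal

set_option linter.unusedSectionVars false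

namespace WT

/-- occurrence of the word `x 1 … x n` after position `k` -/
def occ {A : Type*} (n : ℕ) (x : ℕ → A) (k : ℕ) : Set (ℕ → A) :=
  {ω | ∀ i, 1 ≤ i → i ≤ n → ω (k + i) = x i}

/-- product of transition probabilities along the word `x 1 … x (N+1)` -/
noncomputable def R {A : Type*} (Q : A → A → ℝ) (N : ℕ) (x : ℕ → A) : ℝ :=
  ∏ i ∈ Finset.range N, Q (x (i + 1)) (x (i + 2))

section
variable {A : Type*} [Fintype A] [MeasurableSpace A] [MeasurableSingletonClass A]

lemma meas_occ (n : ℕ) (x : ℕ → A) (k : ℕ) : MeasurableSet (occ n x k) := by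
  have : occ n x k = ⋂ i, ⋂ (_ : 1 ≤ i), ⋂ (_ : i ≤ n), (fun ω : ℕ → A => ω (k + i)) ⁻¹' {x i} := by
    ext ω; simp [occ]
  rw [this]
  refine MeasurableSet.iInter fun i => MeasurableSet.iInter fun _ => MeasurableSet.iInter fun _ => ?_
  exact (measurable_pi_apply _) (measurableSet_singleton _)

lemma sum_cyl (P : Measure (ℕ → A)) [IsProbabilityMeasure P] (m : ℕ) (E : Set (ℕ → A)) :
    P.real E = ∑ b : Fin (m + 1) → A, P.real (E ∩ {ω | ∀ i : Fin (m + 1), ω i = b i}) := by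
  classical
  have hm : ∀ b : Fin (m + 1) → A, MeasurableSet {ω : ℕ → A | ∀ i : Fin (m + 1), ω i = b i} := by
    intro b
    have : {ω : ℕ → A | ∀ i : Fin (m + 1), ω i = b i} =
      ⋂ i : Fin (m + 1), (fun ω : ℕ → A => ω i) ⁻¹' {b i} := by ext ω; simp
    rw [this]
    exact MeasurableSet.iInter fun i => (measurable_pi_apply _) (measurableSet_singleton _)
  have hE : P E = ∑ b : Fin (m + 1) → A, P (E ∩ {ω | ∀ i : Fin (m + 1), ω i = b i}) := by
    have h := measure_iUnion₀ (μ := P.restrict E)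
      (f := fun b : Fin (m + 1) → A => {ω : ℕ → A | ∀ i : Fin (m + 1), ω i = b i}) ?_ ?_
    · rw [tsum_fintype] at h
      have hu : (⋃ b : Fin (m + 1) → A, {ω : ℕ → A | ∀ i : Fin (m + 1), ω i = b i}) = Set.univ := by
        ext ω; simp only [Set.mem_iUnion, Set.mem_ofPred_eq, Set.mem_univ, iff_true]
        exact ⟨fun i => ω i, fun i => rfl⟩
      rw [hu, Measure.restrict_apply_univ] at h
      rw [h]
      refine Finset.sum_congr rfl fun b _ => ?_
      rw [Measure.restrict_apply (hm b), Set.inter_comm]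
    · intro b c hbc
      apply Disjoint.aedisjoint
      rw [Set.disjoint_left]
      intro ω h1 h2
      exact hbc (funext fun i => (h1 i).symm.trans (h2 i))
    · exact fun b => (hm b).nullMeasurableSet
  rw [measureReal_def, hE, ENNReal.toReal_sum (fun _ _ => measure_ne_top _ _)]
  rfl

lemma key (Q : A → A → ℝ) (μ : A → ℝ) (δ : ℝ) (hδ : 0 < δ) (hQ : ∀ x y, δ ≤ Q x y)
    (hQ1 : ∀ x y, Q x y ≤ 1)
    (P : Measure (ℕ → A)) [IsProbabilityMeasure P]
    (hP : ∀ (n : ℕ) (a : ℕ → A),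
      (P {ω | ∀ i ≤ n, ω i = a i}).toReal
        = μ (a 0) * ∏ i ∈ Finset.range n, Q (a i) (a (i + 1)))
    (N : ℕ) (x : ℕ → A) (m : ℕ) (F : Set (ℕ → A))
    (hF : ∀ ω ω' : ℕ → A, (∀ i ≤ m, ω i = ω' i) → ω ∈ F → ω' ∈ F) :
    δ * R Q N x * P.real F ≤ P.real (F ∩ occ (N + 1) x m) ∧
      P.real (F ∩ occ (N + 1) x m) ≤ R Q N x * P.real F := by
  classical
  have hR : 0 ≤ R Q N x := Finset.prod_nonneg fun i _ => hδ.le.trans (hQ _ _)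
  have main : ∀ b : Fin (m + 1) → A,
      δ * R Q N x * P.real (F ∩ {ω | ∀ i : Fin (m + 1), ω i = b i}) ≤
        P.real (F ∩ occ (N + 1) x m ∩ {ω | ∀ i : Fin (m + 1), ω i = b i}) ∧
      P.real (F ∩ occ (N + 1) x m ∩ {ω | ∀ i : Fin (m + 1), ω i = b i}) ≤
        R Q N x * P.real (F ∩ {ω | ∀ i : Fin (m + 1), ω i = b i}) := by
    intro b
    set c : ℕ → A := fun i => if h : i < m + 1 then b ⟨i, h⟩ else x (i - m) with hc
    have c1 : ∀ (i : ℕ) (h : i < m + 1), c i = b ⟨i, h⟩ := fun i h => dif_pos h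
    have c2 : ∀ i, 1 ≤ i → c (m + i) = x i := fun i h => by
      have : ¬ (m + i < m + 1) := by omega
      simp only [hc, dif_neg this, Nat.add_sub_cancel_left]
    by_cases hcF : c ∈ F
    · have e1 : F ∩ {ω | ∀ i : Fin (m + 1), ω i = b i} = {ω | ∀ i ≤ m, ω i = c i} := by
        ext ω
        constructor
        · rintro ⟨_, h⟩ i hi
          rw [c1 i (by omega)]; exact h ⟨i, by omega⟩
        · intro h
          refine ⟨hF c ω (fun i hi => (h i hi).symm) hcF, fun i => ?_⟩
          rw [h i.1 (by omega), c1 i.1 i.2]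
      have e2 : F ∩ occ (N + 1) x m ∩ {ω | ∀ i : Fin (m + 1), ω i = b i} =
          {ω | ∀ i ≤ m + (N + 1), ω i = c i} := by
        rw [Set.inter_right_comm, e1]
        ext ω
        constructor
        · rintro ⟨h, h'⟩ i hi
          by_cases him : i ≤ m
          · exact h i him
          · obtain ⟨j, rfl⟩ : ∃ j, i = m + j := ⟨i - m, by omega⟩
            rw [c2 j (by omega)]; exact h' j (by omega) (by omega)
        · intro h
          refine ⟨fun i hi => h i (by omega), fun i h1 h2 => ?_⟩
          rw [h (m + i) (by omega), c2 i h1]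
      have e3 : P.real {ω | ∀ i ≤ m + (N + 1), ω i = c i} =
          P.real {ω | ∀ i ≤ m, ω i = c i} * (Q (c m) (x 1) * R Q N x) := by
        rw [measureReal_def, measureReal_def, hP, hP, Finset.prod_range_add, Finset.prod_range_succ']
        have : ∏ k ∈ Finset.range N, Q (c (m + (k + 1))) (c (m + (k + 1) + 1)) = R Q N x := by
          refine Finset.prod_congr rfl fun i _ => ?_
          rw [c2 _ (by omega), add_assoc m, c2 _ (by omega)]
        rw [this, add_zero, c2 1 le_rfl]; ring
      rw [e2, e1, e3]
      have hp : 0 ≤ P.real {ω | ∀ i ≤ m, ω i = c i} := measureReal_nonneg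
      have hpR := mul_nonneg hp hR
      constructor
      · nlinarith [mul_le_mul_of_nonneg_left (hQ (c m) (x 1)) hpR]
      · nlinarith [mul_le_mul_of_nonneg_left (hQ1 (c m) (x 1)) hpR]
    · have e1 : F ∩ {ω | ∀ i : Fin (m + 1), ω i = b i} = ∅ := by
        rw [Set.eq_empty_iff_forall_notMem]
        rintro ω ⟨h, h'⟩
        refine hcF (hF ω c (fun i hi => ?_) h)
        rw [c1 i (by omega)]; exact h' ⟨i, by omega⟩
      rw [Set.inter_right_comm, e1]; simp
  rw [sum_cyl P m F, sum_cyl P m (F ∩ occ (N + 1) x m), Finset.mul_sum, Finset.mul_sum]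
  exact ⟨Finset.sum_le_sum fun b _ => (main b).1, Finset.sum_le_sum fun b _ => (main b).2⟩

end

section
variable {A : Type*} [Fintype A] [MeasurableSpace A] [MeasurableSingletonClass A]

/-- two-sided conditional bound for occurrences of a word -/
def Good (P : Measure (ℕ → A)) (n : ℕ) (x : ℕ → A) (δ r : ℝ) : Prop :=
  ∀ (m : ℕ) (F : Set (ℕ → A)),
    (∀ ω ω' : ℕ → A, (∀ i ≤ m, ω i = ω' i) → ω ∈ F → ω' ∈ F) →
    δ * r * P.real F ≤ P.real (F ∩ occ n x m) ∧ P.real (F ∩ occ n x m) ≤ r * P.real F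

/-- the word is not seen in the first `j` blocks -/
def T (n : ℕ) (x : ℕ → A) (j : ℕ) : Set (ℕ → A) := {ω | ∀ i < j, ω ∉ occ n x (i * n + 1)}

lemma T_succ (n : ℕ) (x : ℕ → A) (j : ℕ) :
    T n x (j + 1) = T n x j \ (T n x j ∩ occ n x (j * n + 1)) := by
  ext ω
  simp only [T, Set.mem_ofPred_eq, Set.mem_sdiff, Set.mem_inter_iff, not_and]
  constructor
  · intro h
    exact ⟨fun i hi => h i (by omega), fun _ => h j (by omega)⟩
  · rintro ⟨h, h'⟩ i hi
    rcases Nat.lt_succ_iff_lt_or_eq.mp hi with h1 | rfl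
    · exact h i h1
    · exact h' h

lemma meas_T (n : ℕ) (x : ℕ → A) (j : ℕ) : MeasurableSet (T n x j) := by
  induction j with
  | zero =>
    have : T n x 0 = Set.univ := by ext ω; simp [T]
    rw [this]; exact MeasurableSet.univ
  | succ j ih => rw [T_succ]; exact ih.diff (ih.inter (meas_occ _ _ _))

lemma T_bound {P : Measure (ℕ → A)} [IsProbabilityMeasure P] {n : ℕ} {x : ℕ → A} {δ r : ℝ}
    (hG : Good P n x δ r) (h1 : δ * r ≤ 1) (j : ℕ) : P.real (T n x j) ≤ (1 - δ * r) ^ j := by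
  induction j with
  | zero => simp
  | succ j ih =>
    have h := (hG (j * n + 1) (T n x j) ?_).1
    · rw [T_succ, measureReal_sdiff Set.inter_subset_left ((meas_T n x j).inter (meas_occ _ _ _))]
      have h0 : 0 ≤ 1 - δ * r := by linarith
      have := mul_le_mul_of_nonneg_left ih h0
      rw [pow_succ]
      nlinarith
    · intro ω ω' h hω i hi hocc
      refine hω i hi fun k hk1 hk2 => ?_
      rw [← hocc k hk1 hk2]
      apply h
      have : (i + 1) * n ≤ j * n := Nat.mul_le_mul_right n hi
      have : (i + 1) * n = i * n + n := by ring
      omega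

lemma wt_mem {n : ℕ} {x ω : ℕ → A} (h : waitingTime n x ω ≠ 0) :
    ω ∈ occ n x (waitingTime n x ω) := by
  have := Nat.sInf_mem (Nat.nonempty_of_pos_sInf (Nat.pos_of_ne_zero h))
  exact this.2

lemma wt_not {n : ℕ} {x ω : ℕ → A} {k : ℕ} (hk : 1 ≤ k) (h : k < waitingTime n x ω) :
    ω ∉ occ n x k := fun ho => Nat.notMem_of_lt_sInf h ⟨hk, ho⟩

lemma wt_pos {n : ℕ} {x ω : ℕ → A} {k : ℕ} (hk : 1 ≤ k) (h : ω ∈ occ n x k) :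
    waitingTime n x ω ≠ 0 := by
  have : waitingTime n x ω ∈ {k | 1 ≤ k ∧ ∀ i, 1 ≤ i → i ≤ n → ω (k + i) = x i} :=
    Nat.sInf_mem ⟨k, hk, h⟩
  have := this.1
  omega

lemma meas_wt (n : ℕ) (x : ℕ → A) : Measurable (fun ω : ℕ → A => waitingTime n x ω) := by
  have hpos : ∀ k : ℕ, k ≠ 0 → MeasurableSet ((fun ω : ℕ → A => waitingTime n x ω) ⁻¹' {k}) := by
    intro k hk
    have : (fun ω : ℕ → A => waitingTime n x ω) ⁻¹' {k} =
        occ n x k ∩ ⋂ j, ⋂ (_ : 1 ≤ j), ⋂ (_ : j < k), (occ n x j)ᶜ := by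
      ext ω
      simp only [Set.mem_preimage, Set.mem_singleton_iff, Set.mem_inter_iff, Set.mem_iInter,
        Set.mem_compl_iff]
      constructor
      · rintro rfl
        exact ⟨wt_mem hk, fun j h1 h2 => wt_not h1 h2⟩
      · rintro ⟨h1, h2⟩
        have hle : waitingTime n x ω ≤ k := Nat.sInf_le ⟨by omega, h1⟩
        have hne := wt_pos (by omega) h1
        by_contra hn
        exact h2 _ (by omega) (by omega) (wt_mem hne)
    rw [this]
    exact (meas_occ _ _ _).inter (MeasurableSet.iInter fun j => MeasurableSet.iInter fun _ =>
      MeasurableSet.iInter fun _ => (meas_occ _ _ _).compl)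
  refine measurable_to_countable' fun k => ?_
  by_cases hk : k = 0
  · subst hk
    have : (fun ω : ℕ → A => waitingTime n x ω) ⁻¹' {0} =
        (⋃ k : ℕ, ⋃ (_ : k ≠ 0), (fun ω : ℕ → A => waitingTime n x ω) ⁻¹' {k})ᶜ := by
      ext ω
      simp only [Set.mem_preimage, Set.mem_singleton_iff, Set.mem_compl_iff, Set.mem_iUnion]
      grind
    rw [this]
    exact (MeasurableSet.iUnion fun k => MeasurableSet.iUnion fun h => hpos k h).compl
  · exact hpos k hk

lemma wt_ne_zero_ae {P : Measure (ℕ → A)} [IsProbabilityMeasure P] {n : ℕ} {x : ℕ → A} {δ r : ℝ}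
    (hG : Good P n x δ r) (h0 : 0 < δ * r) (h1 : δ * r ≤ 1) :
    ∀ᵐ ω ∂P, waitingTime n x ω ≠ 0 := by
  rw [ae_iff]
  set Z := {ω : ℕ → A | ¬ waitingTime n x ω ≠ 0} with hZ
  have hb : ∀ j : ℕ, P.real Z ≤ (1 - δ * r) ^ j := by
    intro j
    refine le_trans (measureReal_mono ?_) (T_bound hG h1 j)
    intro ω hω i hi ho
    exact hω (wt_pos (by omega) ho)
  have hl : Tendsto (fun j : ℕ => (1 - δ * r) ^ j) atTop (nhds 0) :=
    tendsto_pow_atTop_nhds_zero_of_lt_one (by linarith) (by linarith)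
  have := ge_of_tendsto' hl hb
  have h2 : P.real Z = 0 := le_antisymm this measureReal_nonneg
  exact (measureReal_eq_zero_iff).mp h2

lemma lint_wt {P : Measure (ℕ → A)} [IsProbabilityMeasure P] {n : ℕ} {x : ℕ → A} {δ r : ℝ}
    (hn : 1 ≤ n) (hG : Good P n x δ r) (h0 : 0 < δ * r) (h1 : δ * r ≤ 1) :
    ∫⁻ ω, (waitingTime n x ω : ENNReal) ∂P ≤ ENNReal.ofReal (n / (δ * r)) := by
  have hpt : ∀ ω : ℕ → A, (waitingTime n x ω : ENNReal) ≤
      n * ∑' j : ℕ, (T n x j).indicator (fun _ => (1 : ENNReal)) ω := by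
    intro ω
    set W := waitingTime n x ω with hW
    by_cases hz : W = 0
    · simp [hz]
    set J := (W - 1) / n with hJ
    have hWJ : W ≤ n * (J + 1) := by
      have := Nat.lt_mul_div_succ (W - 1) hn
      rw [← hJ] at this; omega
    have hT : ∀ j ∈ Finset.range (J + 1), (T n x j).indicator (fun _ => (1 : ENNReal)) ω = 1 := by
      intro j hj
      rw [Set.indicator_of_mem]
      intro i hi
      apply wt_not (by omega)
      rw [← hW]
      have hj' := Finset.mem_range.mp hj
      have h3 : (i + 1) * n ≤ J * n := Nat.mul_le_mul_right n (by omega)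
      have h4 : J * n ≤ W - 1 := Nat.div_mul_le_self _ _
      have h5 : (i + 1) * n = i * n + n := by ring
      omega
    calc (W : ENNReal) ≤ ((n * (J + 1) : ℕ) : ENNReal) := by exact_mod_cast hWJ
      _ = n * ∑ j ∈ Finset.range (J + 1), (T n x j).indicator (fun _ => (1 : ENNReal)) ω := by
        rw [Finset.sum_congr rfl hT]; simp
      _ ≤ _ := by gcongr; exact ENNReal.sum_le_tsum _
  calc ∫⁻ ω, (waitingTime n x ω : ENNReal) ∂P
      ≤ ∫⁻ ω, n * ∑' j : ℕ, (T n x j).indicator (fun _ => (1 : ENNReal)) ω ∂P := lintegral_mono hpt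
    _ = n * ∑' j : ℕ, P (T n x j) := by
      rw [lintegral_const_mul', lintegral_tsum]
      · congr 1
        refine tsum_congr fun j => ?_
        rw [lintegral_indicator (meas_T n x j)]; simp
      · exact fun j => (measurable_const.indicator (meas_T n x j)).aemeasurable
      · simp
    _ ≤ n * ∑' j : ℕ, ENNReal.ofReal ((1 - δ * r) ^ j) := by
      gcongr with j
      rw [← ofReal_measureReal]
      exact ENNReal.ofReal_le_ofReal (T_bound hG h1 j)
    _ = ENNReal.ofReal (n / (δ * r)) := by
      rw [← ENNReal.ofReal_tsum_of_nonneg]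
      · rw [tsum_geometric_of_lt_one (by linarith) (by linarith), ← ENNReal.ofReal_natCast,
          ← ENNReal.ofReal_mul (by positivity)]
        congr 1; rw [sub_sub_cancel]; rfl
      · intro j; exact pow_nonneg (by linarith) j
      · exact summable_geometric_of_lt_one (by linarith) (by linarith)

lemma integrable_wt {P : Measure (ℕ → A)} [IsProbabilityMeasure P] {n : ℕ} {x : ℕ → A} {δ r : ℝ}
    (hn : 1 ≤ n) (hG : Good P n x δ r) (h0 : 0 < δ * r) (h1 : δ * r ≤ 1) :
    Integrable (fun ω => (waitingTime n x ω : ℝ)) P ∧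
      ∫ ω, (waitingTime n x ω : ℝ) ∂P ≤ n / (δ * r) := by
  have hm : Measurable (fun ω : ℕ → A => (waitingTime n x ω : ℝ)) :=
    measurable_from_top.comp (meas_wt n x)
  have hl := lint_wt hn hG h0 h1
  have he : ∀ ω : ℕ → A, ENNReal.ofReal (waitingTime n x ω : ℝ) = (waitingTime n x ω : ENNReal) :=
    fun ω => ENNReal.ofReal_natCast _
  constructor
  · refine ⟨hm.aestronglyMeasurable, ?_⟩
    rw [hasFiniteIntegral_iff_ofReal (Eventually.of_forall fun ω => Nat.cast_nonneg _)]
    simp only [he]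
    exact hl.trans_lt ENNReal.ofReal_lt_top
  · rw [integral_eq_lintegral_of_nonneg_ae (Eventually.of_forall fun ω => Nat.cast_nonneg _)
      hm.aestronglyMeasurable]
    simp only [he]
    exact ENNReal.toReal_le_of_le_ofReal (by positivity) hl

lemma recip {Ω : Type*} [MeasurableSpace Ω] {P : Measure Ω} [IsProbabilityMeasure P] {f g : Ω → ℝ}
    (hf : Integrable f P) (hg : Integrable g P) (hpos : ∀ᵐ ω ∂P, 0 < f ω ∧ g ω = (f ω)⁻¹)
    {B : ℝ} (hB : 0 < B) (h : ∫ ω, g ω ∂P ≤ B) : B⁻¹ ≤ ∫ ω, f ω ∂P := by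
  have h1 : ∫ ω, (2 * B⁻¹ - B⁻¹ ^ 2 * g ω) ∂P ≤ ∫ ω, f ω ∂P := by
    refine integral_mono_ae ((integrable_const _).sub (hg.const_mul _)) hf ?_
    filter_upwards [hpos] with ω ⟨h1, h2⟩
    rw [h2]
    have : 0 ≤ (f ω - B⁻¹) ^ 2 * (f ω)⁻¹ := by positivity
    have e : (f ω - B⁻¹) ^ 2 * (f ω)⁻¹ = f ω - (2 * B⁻¹ - B⁻¹ ^ 2 * (f ω)⁻¹) := by
      field_simp; ring
    linarith
  rw [integral_sub (integrable_const _) (hg.const_mul _), integral_const_mul (B⁻¹ ^ 2) g] at h1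
  simp only [integral_const, probReal_univ, one_smul] at h1
  have : B⁻¹ ^ 2 * ∫ ω, g ω ∂P ≤ B⁻¹ ^ 2 * B := by gcongr
  have e : B⁻¹ ^ 2 * B = B⁻¹ := by field_simp
  linarith
end

section
variable {A : Type*} [Fintype A] [MeasurableSpace A] [MeasurableSingletonClass A]

lemma meas_rpow (n : ℕ) (x : ℕ → A) (s : ℝ) :
    Measurable (fun ω : ℕ → A => (waitingTime n x ω : ℝ) ^ s) :=
  (measurable_from_top (f := fun k : ℕ => (k : ℝ) ^ s)).comp (meas_wt n x)

lemma up {P : Measure (ℕ → A)} [IsProbabilityMeasure P] {n : ℕ} {x : ℕ → A} {δ r : ℝ}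
    (hn : 1 ≤ n) (hG : Good P n x δ r) (h0 : 0 < δ * r) (h1 : δ * r ≤ 1)
    {q : ℝ} (hq0 : 0 ≤ q) (hq1 : q ≤ 1) :
    Integrable (fun ω => (waitingTime n x ω : ℝ) ^ q) P ∧
      ∫ ω, (waitingTime n x ω : ℝ) ^ q ∂P ≤ 2 * (n / (δ * r)) ^ q := by
  obtain ⟨hi, hb⟩ := integrable_wt hn hG h0 h1
  set M : ℝ := n / (δ * r) with hM
  have hMpos : 0 < M := by
    have : (0 : ℝ) < n := by exact_mod_cast hn
    positivity
  have hMq : 0 < M ^ q := rpow_pos_of_pos hMpos q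
  have hpt : ∀ w : ℝ, 0 ≤ w → w ^ q ≤ M ^ q * (1 + w / M) := by
    intro w hw
    have e : w ^ q = M ^ q * (w / M) ^ q := by
      rw [← mul_rpow hMpos.le (by positivity)]; congr 1; field_simp
    rw [e]
    gcongr
    have hu : 0 ≤ w / M := by positivity
    rcases le_total (w / M) 1 with h | h
    · linarith [rpow_le_one hu h hq0]
    · have := rpow_le_rpow_of_exponent_le h hq1
      rw [rpow_one] at this; linarith
  have hid : Integrable (fun ω => M ^ q * (1 + (waitingTime n x ω : ℝ) / M)) P :=
    ((integrable_const _).add (hi.div_const M)).const_mul _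
  have hint : Integrable (fun ω => (waitingTime n x ω : ℝ) ^ q) P := by
    refine hid.mono' (meas_rpow n x q).aestronglyMeasurable (Eventually.of_forall fun ω => ?_)
    rw [Real.norm_of_nonneg (by positivity)]
    exact hpt _ (Nat.cast_nonneg _)
  refine ⟨hint, ?_⟩
  calc ∫ ω, (waitingTime n x ω : ℝ) ^ q ∂P
      ≤ ∫ ω, M ^ q * (1 + (waitingTime n x ω : ℝ) / M) ∂P :=
        integral_mono hint hid fun ω => hpt _ (Nat.cast_nonneg _)
    _ = M ^ q * (1 + (∫ ω, (waitingTime n x ω : ℝ) ∂P) / M) := by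
      rw [integral_const_mul, integral_add (integrable_const _) (hi.div_const M), integral_div]
      simp
    _ ≤ M ^ q * (1 + M / M) := by gcongr
    _ = 2 * M ^ q := by rw [div_self hMpos.ne']; ring

lemma sum_rpow {q : ℝ} (hq0 : 0 ≤ q) (hq1 : q < 1) (M : ℕ) :
    ∑ k ∈ Finset.Icc 1 M, (k : ℝ) ^ (-q) ≤ (M : ℝ) ^ (1 - q) / (1 - q) := by
  induction M with
  | zero => simp [zero_rpow (by linarith : (1 - q) ≠ 0)]
  | succ m ih =>
    rw [Finset.sum_Icc_succ_top (by omega)]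
    have hm : (0 : ℝ) < (m : ℝ) + 1 := by positivity
    have h1 : (0 : ℝ) < 1 - q := by linarith
    have hb : (m : ℝ) ^ (1 - q) ≤
        ((m : ℝ) + 1) ^ (1 - q) - (1 - q) * ((m : ℝ) + 1) ^ (-q) := by
      have e : (m : ℝ) = ((m : ℝ) + 1) * (1 + -(1 / ((m : ℝ) + 1))) := by field_simp; ring
      have hs : (-1 : ℝ) ≤ -(1 / ((m : ℝ) + 1)) := by
        have : 1 / ((m : ℝ) + 1) ≤ 1 := by
          rw [div_le_one hm]; linarith [Nat.cast_nonneg (α := ℝ) m]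
        linarith
      have := rpow_one_add_le_one_add_mul_self hs h1.le (by linarith : 1 - q ≤ 1)
      have e2 : ((m : ℝ) + 1) ^ (1 - q) = ((m : ℝ) + 1) ^ (-q) * ((m : ℝ) + 1) := by
        rw [← rpow_add_one hm.ne']; congr 1; ring
      have hp : 0 < ((m : ℝ) + 1) ^ (-q) := rpow_pos_of_pos hm _
      calc (m : ℝ) ^ (1 - q) = ((m : ℝ) + 1) ^ (1 - q) * (1 + -(1 / ((m : ℝ) + 1))) ^ (1 - q) := by
            rw [← mul_rpow hm.le (by linarith), ← e]
        _ ≤ ((m : ℝ) + 1) ^ (1 - q) * (1 + (1 - q) * -(1 / ((m : ℝ) + 1))) := by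
            gcongr
        _ = _ := by rw [e2]; field_simp; ring
    push_cast
    rw [le_div_iff₀ h1] at ih ⊢
    nlinarith

lemma dn {P : Measure (ℕ → A)} [IsProbabilityMeasure P] {n : ℕ} {x : ℕ → A} {δ r : ℝ}
    (hG : Good P n x δ r) (h0 : 0 < δ * r) (h1 : δ * r ≤ 1) (hr0 : 0 < r) (hr1 : r ≤ 1)
    {q : ℝ} (hq0 : 0 ≤ q) (hq1 : q < 1) :
    Integrable (fun ω => (waitingTime n x ω : ℝ) ^ (-q)) P ∧
      ∫ ω, (waitingTime n x ω : ℝ) ^ (-q) ∂P ≤ (1 + 2 / (1 - q)) * r ^ q := by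
  have hae := wt_ne_zero_ae hG h0 h1
  have hint : Integrable (fun ω => (waitingTime n x ω : ℝ) ^ (-q)) P := by
    refine (integrable_const (1 : ℝ)).mono' (meas_rpow n x (-q)).aestronglyMeasurable ?_
    filter_upwards [hae] with ω hω
    rw [Real.norm_of_nonneg (by positivity)]
    refine rpow_le_one_of_one_le_of_nonpos ?_ (by linarith)
    exact_mod_cast Nat.one_le_iff_ne_zero.mpr hω
  refine ⟨hint, ?_⟩
  set M : ℕ := ⌈1 / r⌉₊ with hM
  have hM1 : 1 / r ≤ M := Nat.le_ceil _
  have hr1' : 1 ≤ 1 / r := by rw [le_div_iff₀ hr0]; linarith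
  have hM2 : (M : ℝ) ≤ 2 / r := by
    have := (Nat.ceil_lt_add_one (by positivity : 0 ≤ 1 / r)).le
    have e : 2 / r = 1 / r + 1 / r := by ring
    rw [e]; linarith
  have hMpos : (0 : ℝ) < M := by linarith
  have hms : ∀ k : ℕ, MeasurableSet {ω : ℕ → A | waitingTime n x ω = k} := fun k =>
    meas_wt n x (measurableSet_singleton k)
  have hids : ∀ k ∈ Finset.Icc 1 M, Integrable (fun ω => (k : ℝ) ^ (-q) *
      {ω : ℕ → A | waitingTime n x ω = k}.indicator (fun _ => (1 : ℝ)) ω) P := fun k _ =>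
    ((integrable_const (1 : ℝ)).indicator (hms k)).const_mul _
  have hle : ∫ ω, (waitingTime n x ω : ℝ) ^ (-q) ∂P ≤
      ∫ ω, ((M : ℝ) ^ (-q) + ∑ k ∈ Finset.Icc 1 M, (k : ℝ) ^ (-q) *
        {ω : ℕ → A | waitingTime n x ω = k}.indicator (fun _ => (1 : ℝ)) ω) ∂P := by
    refine integral_mono_ae hint ((integrable_const _).add (integrable_finsetSum _ hids)) ?_
    filter_upwards [hae] with ω hω
    have hnn : ∀ k ∈ Finset.Icc 1 M, 0 ≤ (k : ℝ) ^ (-q) *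
        {ω : ℕ → A | waitingTime n x ω = k}.indicator (fun _ => (1 : ℝ)) ω := fun k _ =>
      mul_nonneg (by positivity) (Set.indicator_nonneg (fun _ _ => zero_le_one) _)
    rcases le_or_gt (waitingTime n x ω) M with h | h
    · have := Finset.single_le_sum hnn (Finset.mem_Icc.mpr ⟨Nat.one_le_iff_ne_zero.mpr hω, h⟩)
      rw [Set.indicator_of_mem (by rfl)] at this
      have h3 : 0 ≤ (M : ℝ) ^ (-q) := by positivity
      simp only [mul_one] at this
      linarith
    · have h3 : (waitingTime n x ω : ℝ) ^ (-q) ≤ (M : ℝ) ^ (-q) :=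
        rpow_le_rpow_of_nonpos hMpos (by exact_mod_cast h.le) (by linarith)
      linarith [Finset.sum_nonneg hnn]
  rw [integral_add (integrable_const _) (integrable_finsetSum _ hids),
    integral_finsetSum _ hids] at hle
  have hk : ∀ k ∈ Finset.Icc 1 M, ∫ ω, (k : ℝ) ^ (-q) *
      {ω : ℕ → A | waitingTime n x ω = k}.indicator (fun _ => (1 : ℝ)) ω ∂P ≤
      r * (k : ℝ) ^ (-q) := by
    intro k hk
    have hk1 := (Finset.mem_Icc.mp hk).1
    rw [integral_const_mul, integral_indicator_const _ (hms k), mul_comm]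
    simp only [smul_eq_mul, mul_one]
    gcongr
    have h2 := (hG k Set.univ (fun _ _ _ _ => trivial)).2
    rw [probReal_univ, mul_one, Set.univ_inter] at h2
    refine le_trans (measureReal_mono ?_) h2
    intro ω hω
    have hω' : waitingTime n x ω = k := hω
    have := wt_mem (n := n) (x := x) (ω := ω) (by omega)
    rwa [hω'] at this
  have hs := Finset.sum_le_sum hk
  rw [← Finset.mul_sum] at hs
  have hs2 := mul_le_mul_of_nonneg_left (sum_rpow hq0 hq1 M) hr0.le
  have hq : 0 < 1 - q := by linarith
  have hc : (M : ℝ) ^ (-q) ≤ r ^ q := by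
    have := rpow_le_rpow_of_nonpos (by positivity) hM1 (by linarith : -q ≤ 0)
    rwa [one_div, inv_rpow hr0.le, rpow_neg hr0.le, inv_inv] at this
  have hd : r * ((M : ℝ) ^ (1 - q) / (1 - q)) ≤ 2 / (1 - q) * r ^ q := by
    have h2 : (M : ℝ) ^ (1 - q) ≤ (2 / r) ^ (1 - q) := by gcongr
    have h3 : (2 / r) ^ (1 - q) = 2 ^ (1 - q) * (r⁻¹ * r ^ q) := by
      rw [div_rpow (by norm_num) hr0.le, rpow_sub hr0, rpow_one]; field_simp
    have h4 : (2 : ℝ) ^ (1 - q) ≤ 2 := by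
      have := rpow_le_rpow_of_exponent_le (by norm_num : (1 : ℝ) ≤ 2) (by linarith : 1 - q ≤ 1)
      rwa [rpow_one] at this
    have h5 : (M : ℝ) ^ (1 - q) ≤ 2 * (r⁻¹ * r ^ q) := by
      rw [h3] at h2
      refine h2.trans ?_
      gcongr
    calc r * ((M : ℝ) ^ (1 - q) / (1 - q)) ≤ r * ((2 * (r⁻¹ * r ^ q)) / (1 - q)) := by gcongr
      _ = _ := by field_simp
  simp only [integral_const, probReal_univ, one_smul] at hle
  linarith

lemma moments {P : Measure (ℕ → A)} [IsProbabilityMeasure P] {n : ℕ} {x : ℕ → A} {δ r w : ℝ}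
    (hn : 1 ≤ n) (hG : Good P n x δ r) (hδ0 : 0 < δ) (hδ1 : δ ≤ 1) (hr0 : 0 < r) (hr1 : r ≤ 1)
    (hw1 : δ * r ≤ w) (hw2 : w ≤ r)
    {s : ℝ} (hs : |s| < 1) :
    Integrable (fun ω => (waitingTime n x ω : ℝ) ^ s) P ∧
      ∫ ω, (waitingTime n x ω : ℝ) ^ s ∂P ≤ (2 * (1 + 2 / (1 - |s|)) / δ * n) * w ^ (-s) ∧
      (2 * (1 + 2 / (1 - |s|)) / δ * n)⁻¹ * w ^ (-s) ≤ ∫ ω, (waitingTime n x ω : ℝ) ^ s ∂P := by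
  have h0 : 0 < δ * r := by positivity
  have h1 : δ * r ≤ 1 := by nlinarith
  have hn' : (1 : ℝ) ≤ n := by exact_mod_cast hn
  have hn0 : (0 : ℝ) < n := by linarith
  have hw0 : 0 < w := by linarith
  set q := |s| with hq
  have hq0 : 0 ≤ q := abs_nonneg s
  obtain ⟨iu, bu⟩ := up hn hG h0 h1 hq0 hs.le
  obtain ⟨id, bd⟩ := dn hG h0 h1 hr0 hr1 hq0 hs
  have hae := wt_ne_zero_ae hG h0 h1
  set K := 1 + 2 / (1 - q) with hK
  have hK1 : 1 ≤ K := by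
    have : 0 < 1 - q := by linarith
    have : 0 < 2 / (1 - q) := by positivity
    linarith
  have hK0 : 0 < K := by linarith
  have hrq : 0 < r ^ q := rpow_pos_of_pos hr0 q
  have hwq : 0 < w ^ q := rpow_pos_of_pos hw0 q
  -- comparison of powers
  have c1 : w ^ q ≤ r ^ q := by gcongr
  have c2 : δ * r ^ q ≤ w ^ q := by
    have : (δ * r) ^ q ≤ w ^ q := by gcongr
    rw [mul_rpow hδ0.le hr0.le] at this
    have h2 : δ ≤ δ ^ q := by
      have := rpow_le_rpow_of_exponent_ge hδ0 hδ1 hs.le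
      rwa [rpow_one] at this
    nlinarith
  have hU : 2 * (n / (δ * r)) ^ q ≤ 2 * n / δ * (r ^ q)⁻¹ := by
    have e : (n / (δ * r)) ^ q = (n / δ) ^ q * (r ^ q)⁻¹ := by
      rw [← inv_rpow hr0.le, ← mul_rpow (by positivity) (by positivity)]; congr 1; field_simp
    have h2 : ((n : ℝ) / δ) ^ q ≤ n / δ := by
      have : 1 ≤ (n : ℝ) / δ := by rw [le_div_iff₀ hδ0]; linarith
      have := rpow_le_rpow_of_exponent_le this hs.le
      rwa [rpow_one] at this
    rw [e]
    calc 2 * (((n : ℝ) / δ) ^ q * (r ^ q)⁻¹) ≤ 2 * ((n : ℝ) / δ * (r ^ q)⁻¹) := by gcongr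
      _ = _ := by ring
  have bu' := bu.trans hU
  have lu : (K * r ^ q)⁻¹ ≤ ∫ ω, (waitingTime n x ω : ℝ) ^ q ∂P := by
    refine recip iu id ?_ (by positivity) bd
    filter_upwards [hae] with ω hω
    have : (0 : ℝ) < waitingTime n x ω := by exact_mod_cast Nat.pos_of_ne_zero hω
    exact ⟨rpow_pos_of_pos this _, rpow_neg this.le _⟩
  have ld : (2 * n / δ * (r ^ q)⁻¹)⁻¹ ≤ ∫ ω, (waitingTime n x ω : ℝ) ^ (-q) ∂P := by
    refine recip id iu ?_ (by positivity) bu'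
    filter_upwards [hae] with ω hω
    have : (0 : ℝ) < waitingTime n x ω := by exact_mod_cast Nat.pos_of_ne_zero hω
    exact ⟨rpow_pos_of_pos this _, by rw [rpow_neg this.le, inv_inv]⟩
  rcases le_total 0 s with h | h
  · have hsq : q = s := abs_of_nonneg h
    rw [← hsq, rpow_neg hw0.le]
    refine ⟨iu, bu'.trans ?_, le_trans ?_ lu⟩
    · have h2 : (r ^ q)⁻¹ ≤ (w ^ q)⁻¹ := by gcongr
      have h3 : 2 * (n : ℝ) / δ ≤ 2 * K / δ * n := by
        rw [div_mul_eq_mul_div]; gcongr ?_ / δ; nlinarith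
      gcongr
    · rw [← mul_inv]
      refine inv_anti₀ (by positivity) ?_
      have h3 : K * r ^ q ≤ K / δ * w ^ q := by
        calc K * r ^ q = K / δ * (δ * r ^ q) := by field_simp
          _ ≤ _ := by gcongr
      refine h3.trans ?_
      gcongr
      rw [div_mul_eq_mul_div]; gcongr ?_ / δ; nlinarith
  · have hsq : -q = s := by rw [hq, abs_of_nonpos h, neg_neg]
    rw [← hsq, neg_neg]
    refine ⟨id, bd.trans ?_, le_trans ?_ ld⟩
    · have h3 : K * r ^ q ≤ K / δ * w ^ q := by
        calc K * r ^ q = K / δ * (δ * r ^ q) := by field_simp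
          _ ≤ _ := by gcongr
      refine h3.trans ?_
      gcongr
      rw [div_mul_eq_mul_div]; gcongr ?_ / δ; nlinarith
    · rw [mul_inv (2 * (n : ℝ) / δ), inv_inv]
      gcongr
      rw [div_mul_eq_mul_div]; gcongr ?_ / δ; nlinarith
end

section
variable {A : Type*} [Fintype A] [MeasurableSpace A] [MeasurableSingletonClass A]

lemma chain [Nonempty A] (Q : A → A → ℝ) (μ : A → ℝ) (hQpos : ∀ x y, 0 < Q x y)
    (hQrow : ∀ x, ∑ y, Q x y = 1)
    (P : Measure (ℕ → A)) [IsProbabilityMeasure P]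
    (hP : ∀ (n : ℕ) (a : ℕ → A),
      (P {ω | ∀ i ≤ n, ω i = a i}).toReal
        = μ (a 0) * ∏ i ∈ Finset.range n, Q (a i) (a (i + 1)))
    {s : ℝ} (hs : |s| < 1) :
    ∃ C : ℝ, 0 < C ∧ ∀ n : ℕ, 1 ≤ n → ∀ (a : Fin n → A) (x : ℕ → A),
      (∀ i : Fin n, x (i.1 + 1) = a i) →
      0 < wordProb P n a ∧ Integrable (fun ω => (waitingTime n x ω : ℝ) ^ s) P ∧
      ∫ ω, (waitingTime n x ω : ℝ) ^ s ∂P ≤ C * n * wordProb P n a ^ (-s) ∧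
      (C * n)⁻¹ * wordProb P n a ^ (-s) ≤ ∫ ω, (waitingTime n x ω : ℝ) ^ s ∂P := by
  obtain ⟨z, hz⟩ := Finite.exists_min (fun z : A × A => Q z.1 z.2)
  set δ := Q z.1 z.2 with hδ
  have hδ0 : 0 < δ := hQpos _ _
  have hQδ : ∀ x y, δ ≤ Q x y := fun x y => hz (x, y)
  have hQ1 : ∀ x y, Q x y ≤ 1 := fun x y => by
    rw [← hQrow x]
    exact Finset.single_le_sum (f := fun y => Q x y) (fun y _ => (hQpos x y).le) (Finset.mem_univ y)
  have h1s : 0 < 1 - |s| := by linarith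
  refine ⟨2 * (1 + 2 / (1 - |s|)) / δ, by positivity, ?_⟩
  intro n hn a x hx
  obtain ⟨N, rfl⟩ : ∃ N, n = N + 1 := ⟨n - 1, by omega⟩
  have hG : Good P (N + 1) x δ (R Q N x) := fun m F hF =>
    key Q μ δ hδ0 hQδ hQ1 P hP N x m F hF
  have hr0 : 0 < R Q N x := Finset.prod_pos fun i _ => hQpos _ _
  have hr1 : R Q N x ≤ 1 := Finset.prod_le_one (fun i _ => (hQpos _ _).le) fun i _ => hQ1 _ _
  have hw : wordProb P (N + 1) a = P.real (Set.univ ∩ occ (N + 1) x 0) := by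
    rw [Set.univ_inter, wordProb, measureReal_def]
    congr 2
    ext ω
    constructor
    · intro h i h1 h2
      have h3 := h ⟨i - 1, by omega⟩
      rw [← hx] at h3
      simpa [Nat.sub_add_cancel h1] using h3
    · intro h i
      have := h (i.1 + 1) (by omega) (by omega)
      rw [← hx, ← this, zero_add]
  have hw12 := hG 0 Set.univ (fun _ _ _ _ => trivial)
  rw [← hw, probReal_univ, mul_one, mul_one] at hw12
  have hm := moments hn hG hδ0 (hQ1 _ _) hr0 hr1 hw12.1 hw12.2 hs
  have : 0 < δ * R Q N x := by positivity
  exact ⟨by linarith [hw12.1], hm⟩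

/-- an infinite sequence extending a word -/
noncomputable def ext [Nonempty A] {n : ℕ} (a : Fin n → A) : ℕ → A :=
  fun i => if h : i - 1 < n then a ⟨i - 1, h⟩ else Classical.arbitrary A

lemma ext_spec [Nonempty A] {n : ℕ} (a : Fin n → A) (i : Fin n) : ext a (i.1 + 1) = a i := by
  simp [ext]

lemma decomp [Nonempty A] (P Pt : Measure (ℕ → A)) [IsProbabilityMeasure P]
    [IsProbabilityMeasure Pt] (p : ℝ) (n : ℕ)
    (h1 : ∀ a : Fin n → A, Integrable (fun ω => (waitingTime n (ext a) ω : ℝ) ^ p) Pt)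
    (h2 : ∀ a : Fin n → A, Integrable (fun ω => (waitingTime n (ext a) ω : ℝ) ^ (-p)) P) :
    ∫ z, ((waitingTime n z.1.1 z.1.2 : ℝ) / (waitingTime n z.1.1 z.2 : ℝ)) ^ p
              ∂((P.prod Pt).prod P) =
      ∑ a : Fin n → A, wordProb P n a * (∫ ω, (waitingTime n (ext a) ω : ℝ) ^ p ∂Pt) *
        ∫ ω, (waitingTime n (ext a) ω : ℝ) ^ (-p) ∂P := by
  classical
  set S : (Fin n → A) → Set (ℕ → A) := fun a => {ω | ∀ i : Fin n, ω (i.1 + 1) = a i} with hS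
  have hSm : ∀ a, MeasurableSet (S a) := by
    intro a
    have : S a = ⋂ i : Fin n, (fun ω : ℕ → A => ω (i.1 + 1)) ⁻¹' {a i} := by ext ω; simp [hS]
    rw [this]
    exact MeasurableSet.iInter fun i => (measurable_pi_apply _) (measurableSet_singleton _)
  have hpt : ∀ z : ((ℕ → A) × (ℕ → A)) × (ℕ → A),
      ((waitingTime n z.1.1 z.1.2 : ℝ) / (waitingTime n z.1.1 z.2 : ℝ)) ^ p =
      ∑ a : Fin n → A, (S a).indicator (fun _ => (1 : ℝ)) z.1.1 *
        (waitingTime n (ext a) z.1.2 : ℝ) ^ p * (waitingTime n (ext a) z.2 : ℝ) ^ (-p) := by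
    rintro ⟨⟨x, y⟩, y'⟩
    dsimp only
    rw [Finset.sum_eq_single (fun i : Fin n => x (i.1 + 1))]
    · have hw : ∀ y : ℕ → A, waitingTime n (ext fun i : Fin n => x (i.1 + 1)) y
          = waitingTime n x y := by
        intro y
        have : ∀ i, 1 ≤ i → i ≤ n → ext (fun i : Fin n => x (i.1 + 1)) i = x i := by
          intro i hi1 hi2
          have := ext_spec (fun i : Fin n => x (i.1 + 1)) ⟨i - 1, by omega⟩
          simpa [Nat.sub_add_cancel hi1] using this
        unfold waitingTime
        congr 1
        ext k
        refine and_congr_right fun _ => forall_congr' fun i => forall_congr' fun hi1 =>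
          forall_congr' fun hi2 => ?_
        rw [this i hi1 hi2]
      rw [Set.indicator_of_mem (by intro i; rfl), hw, hw, one_mul,
        div_rpow (Nat.cast_nonneg _) (Nat.cast_nonneg _), rpow_neg (Nat.cast_nonneg _)]
      rfl
    · intro b _ hb
      rw [Set.indicator_of_notMem, zero_mul, zero_mul]
      intro h
      exact hb (funext fun i => (h i).symm)
    · intro h; exact absurd (Finset.mem_univ _) h
  have hi : ∀ a, Integrable (fun x : ℕ → A => (S a).indicator (fun _ => (1 : ℝ)) x) P := fun a =>
    (integrable_const (1 : ℝ)).indicator (hSm a)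
  simp_rw [hpt]
  rw [integral_finsetSum]
  · refine Finset.sum_congr rfl fun a _ => ?_
    rw [integral_prod_mul (μ := P.prod Pt) (ν := P) (fun u : (ℕ → A) × (ℕ → A) =>
      (S a).indicator (fun _ => (1 : ℝ)) u.1 * (waitingTime n (ext a) u.2 : ℝ) ^ p)
      (fun v => (waitingTime n (ext a) v : ℝ) ^ (-p)),
      integral_prod_mul (μ := P) (ν := Pt) ((S a).indicator (fun _ => (1 : ℝ)))
        (fun v => (waitingTime n (ext a) v : ℝ) ^ p), integral_indicator_const _ (hSm a)]
    simp [wordProb, measureReal_def, hS]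
  · intro a _
    exact ((hi a).mul_prod (h1 a)).mul_prod (h2 a)

lemma squeeze {E S : ℕ → ℝ} {C : ℝ} (hC : 0 < C) (hS : ∀ n, 1 ≤ n → 0 < S n)
    (hu : ∀ n : ℕ, 1 ≤ n → E n ≤ C * n ^ 2 * S n)
    (hl : ∀ n : ℕ, 1 ≤ n → (C * n ^ 2)⁻¹ * S n ≤ E n) :
    Tendsto (fun n : ℕ => (Real.log (E n) - Real.log (S n)) / n) atTop (nhds 0) := by
  have hlim : Tendsto (fun n : ℕ => (Real.log C + 2 * Real.log n) / n) atTop (nhds 0) := by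
    have a1 : Tendsto (fun n : ℕ => Real.log C / (n : ℝ)) atTop (nhds 0) :=
      tendsto_const_div_atTop_nhds_zero_nat _
    have a2 : Tendsto (fun n : ℕ => Real.log (n : ℝ) / (n : ℝ)) atTop (nhds 0) :=
      (Real.isLittleO_log_id_atTop.tendsto_div_nhds_zero).comp tendsto_natCast_atTop_atTop
    have a3 := a1.add (a2.const_mul 2)
    rw [mul_zero, add_zero] at a3
    refine a3.congr fun n => ?_
    ring
  refine squeeze_zero_norm' ?_ hlim
  filter_upwards [eventually_ge_atTop 1] with n hn
  have hn0 : (0 : ℝ) < n := by exact_mod_cast hn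
  have hSn := hS n hn
  have hD : 0 < C * (n : ℝ) ^ 2 := by positivity
  have hE : 0 < E n := lt_of_lt_of_le (by positivity) (hl n hn)
  have hlog : Real.log (C * (n : ℝ) ^ 2) = Real.log C + 2 * Real.log n := by
    rw [Real.log_mul hC.ne' (by positivity), Real.log_pow]; norm_num
  have u := Real.log_le_log hE (hu n hn)
  have l := Real.log_le_log (by positivity) (hl n hn)
  rw [Real.log_mul hD.ne' hSn.ne', hlog] at u
  rw [Real.log_mul (by positivity) hSn.ne', Real.log_inv, hlog] at l
  rw [Real.norm_eq_abs, abs_div, abs_of_pos hn0]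
  gcongr
  rw [abs_le]
  constructor <;> linarith
end

end WT

/-- Logarithmic equivalence of `E[(W_n(X|Y)/W_n(X|X'))^p]` and
`∑_{a ∈ Aⁿ} P_n(a)^{1+p} P~_n(a)^{-p}` for `|p| < 1`. -/
theorem stmt7
    {A : Type*} [Fintype A] [Nonempty A] [MeasurableSpace A] [MeasurableSingletonClass A]
    (QX QY : A → A → ℝ) (μ μt : A → ℝ)
    (hQXpos : ∀ x y, 0 < QX x y) (hQXrow : ∀ x, ∑ y, QX x y = 1)
    (hQYpos : ∀ x y, 0 < QY x y) (hQYrow : ∀ x, ∑ y, QY x y = 1)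
    (hμnonneg : ∀ x, 0 ≤ μ x) (hμsum : ∑ x, μ x = 1)
    (hμstat : ∀ y, ∑ x, μ x * QX x y = μ y)
    (hμtnonneg : ∀ x, 0 ≤ μt x) (hμtsum : ∑ x, μt x = 1)
    (hμtstat : ∀ y, ∑ x, μt x * QY x y = μt y)
    (P Pt : Measure (ℕ → A)) [IsProbabilityMeasure P] [IsProbabilityMeasure Pt]
    (hP : ∀ (n : ℕ) (a : ℕ → A),
      (P {ω | ∀ i ≤ n, ω i = a i}).toReal
        = μ (a 0) * ∏ i ∈ Finset.range n, QX (a i) (a (i + 1)))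
    (hPt : ∀ (n : ℕ) (a : ℕ → A),
      (Pt {ω | ∀ i ≤ n, ω i = a i}).toReal
        = μt (a 0) * ∏ i ∈ Finset.range n, QY (a i) (a (i + 1))) :
    ∀ p : ℝ, |p| < 1 →
      Tendsto (fun n : ℕ =>
          (Real.log (∫ z, ((waitingTime n z.1.1 z.1.2 : ℝ) / (waitingTime n z.1.1 z.2 : ℝ)) ^ p
              ∂((P.prod Pt).prod P))
            - Real.log (∑ a : Fin n → A,
                (wordProb P n a) ^ (1 + p) * (wordProb Pt n a) ^ (-p))) / n)
        atTop (nhds 0) := by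
  intro p hp
  obtain ⟨C1, hC1, H1⟩ := WT.chain QY μt hQYpos hQYrow Pt hPt hp
  obtain ⟨C2, hC2, H2⟩ := WT.chain QX μ hQXpos hQXrow P hP (s := -p) (by rwa [abs_neg])
  have hterm : ∀ n : ℕ, 1 ≤ n → ∀ a : Fin n → A,
      (wordProb P n a) ^ (1 + p) = wordProb P n a * wordProb P n a ^ p := by
    intro n hn a
    rw [rpow_add (H2 n hn a _ (WT.ext_spec a)).1, rpow_one]
  have hdec : ∀ n : ℕ, 1 ≤ n → _ := fun n hn => WT.decomp P Pt p n
    (fun a => (H1 n hn a _ (WT.ext_spec a)).2.1) (fun a => (H2 n hn a _ (WT.ext_spec a)).2.1)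
  refine WT.squeeze (C := C1 * C2) (by positivity) ?_ ?_ ?_
  · intro n hn
    refine Finset.sum_pos (fun a _ => ?_) Finset.univ_nonempty
    exact mul_pos (rpow_pos_of_pos (H2 n hn a _ (WT.ext_spec a)).1 _)
      (rpow_pos_of_pos (H1 n hn a _ (WT.ext_spec a)).1 _)
  · intro n hn
    rw [hdec n hn, Finset.mul_sum]
    refine Finset.sum_le_sum fun a _ => ?_
    obtain ⟨p1, -, u1, l1⟩ := H1 n hn a _ (WT.ext_spec a)
    obtain ⟨p2, -, u2, l2⟩ := H2 n hn a _ (WT.ext_spec a)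
    rw [neg_neg] at u2 l2
    rw [hterm n hn]
    calc _ ≤ wordProb P n a * (C1 * n * wordProb Pt n a ^ (-p)) * (C2 * n * wordProb P n a ^ p) := by
          refine mul_le_mul (mul_le_mul_of_nonneg_left u1 p2.le) u2
            (integral_nonneg fun ω => by positivity) (by positivity)
      _ = _ := by ring
  · intro n hn
    have hn0 : (0 : ℝ) < n := by exact_mod_cast hn
    rw [hdec n hn, Finset.mul_sum]
    refine Finset.sum_le_sum fun a _ => ?_
    obtain ⟨p1, -, u1, l1⟩ := H1 n hn a _ (WT.ext_spec a)
    obtain ⟨p2, -, u2, l2⟩ := H2 n hn a _ (WT.ext_spec a)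
    rw [neg_neg] at u2 l2
    rw [hterm n hn]
    calc _ = wordProb P n a * ((C1 * n)⁻¹ * wordProb Pt n a ^ (-p)) *
            ((C2 * n)⁻¹ * wordProb P n a ^ p) := by
          rw [mul_inv, mul_inv, mul_inv, mul_inv]; ring
      _ ≤ _ := by
          refine mul_le_mul (mul_le_mul_of_nonneg_left l1 p2.le) l2 (by positivity)
            (mul_nonneg p2.le (integral_nonneg fun ω => by positivity))
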